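/- arXiv:1504.02716 — 4 statements merged into one kernel-verified Lean document; each statement's English description precedes it below -/
import Mathlib

section
/- Every graph in the language of a B-ESG grammar is a string graph. That is, if B = (G,T) is a B-ESG grammar with initial non-terminal S, and H is any graph with a concrete derivation S ⟹*_B H (a derivation in the B-edNCE grammar G to a graph with no non-terminals, followed by decoding with T), then H is a string graph. -/
set_option linter.dupNamespace false

namespace BESG

/-- Vertex labels: terminal node-vertex labels `NL`, terminal wire-vertex labels `WL`,
or non-terminal labels `NT`. -/
abbrev VLab (NL WL NT : Type) := (NL ⊕ WL) ⊕ NT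

def isNodeL {NL WL NT : Type} : VLab NL WL NT → Bool
  | .inl (.inl _) => true
  | _ => false

def isWireL {NL WL NT : Type} : VLab NL WL NT → Bool
  | .inl (.inr _) => true
  | _ => false

def isNTL {NL WL NT : Type} : VLab NL WL NT → Bool
  | .inr _ => true
  | _ => false

/-- A finite directed labelled graph with vertices drawn from `ℕ`, no self-loops,
and parallel edges allowed only with distinct edge labels. -/
structure Graph (VL Ga : Type) where
  verts : Finset ℕ
  edges : Finset (ℕ × Ga × ℕ)
  lab : ℕ → VL
  edge_src : ∀ e ∈ edges, e.1 ∈ verts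
  edge_tgt : ∀ e ∈ edges, e.2.2 ∈ verts
  no_loop : ∀ e ∈ edges, e.1 ≠ e.2.2

variable {NL WL NT EL : Type}

/-- Graphs over the label alphabet of a string-graph grammar. -/
abbrev SG (NL WL NT EL : Type) := Graph (VLab NL WL NT) EL

def inDeg (H : SG NL WL NT EL) (v : ℕ) : ℕ := (H.edges.filter fun e => e.2.2 = v).card

def outDeg (H : SG NL WL NT EL) (v : ℕ) : ℕ := (H.edges.filter fun e => e.1 = v).card

/-- The graph contains no non-terminal vertices. -/
def NoNT (H : SG NL WL NT EL) : Prop := ∀ v ∈ H.verts, ¬ isNTL (H.lab v)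

/-- A string graph: no non-terminals, no edges between node-vertices, and every
wire-vertex has in-degree and out-degree at most one. -/
def IsStringGraph (H : SG NL WL NT EL) : Prop :=
  NoNT H ∧
  (∀ e ∈ H.edges, ¬ (isNodeL (H.lab e.1) ∧ isNodeL (H.lab e.2.2))) ∧
  (∀ v ∈ H.verts, isWireL (H.lab v) → inDeg H v ≤ 1 ∧ outDeg H v ≤ 1)

/-- An encoded string graph: like a string graph, but edges between node-vertices
are allowed exactly when they carry an encoding label from `enc`. -/
def IsEncodedSG (enc : Finset EL) (H : SG NL WL NT EL) : Prop :=
  NoNT H ∧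
  (∀ e ∈ H.edges, ((isNodeL (H.lab e.1) ∧ isNodeL (H.lab e.2.2)) ↔ e.2.1 ∈ enc)) ∧
  (∀ v ∈ H.verts, isWireL (H.lab v) → inDeg H v ≤ 1 ∧ outDeg H v ≤ 1)

/-- Inputs: wire-vertices with no incoming edge. -/
def Inputs (H : SG NL WL NT EL) : Finset ℕ :=
  H.verts.filter fun v => isWireL (H.lab v) = true ∧ inDeg H v = 0

/-- Outputs: wire-vertices with no outgoing edge. -/
def Outputs (H : SG NL WL NT EL) : Finset ℕ :=
  H.verts.filter fun v => isWireL (H.lab v) = true ∧ outDeg H v = 0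

def Boundary (H : SG NL WL NT EL) : Finset ℕ := Inputs H ∪ Outputs H

def NTVerts (H : SG NL WL NT EL) : Finset ℕ :=
  H.verts.filter fun v => isNTL (H.lab v) = true

def wireVertexCount (H : SG NL WL NT EL) : ℕ :=
  (H.verts.filter fun v => isWireL (H.lab v) = true).card

def Adj (H : SG NL WL NT EL) (u w : ℕ) : Prop :=
  ∃ γ, (u, γ, w) ∈ H.edges ∨ (w, γ, u) ∈ H.edges

def ConnectedG (H : SG NL WL NT EL) : Prop :=
  ∀ u ∈ H.verts, ∀ w ∈ H.verts, Relation.ReflTransGen (Adj H) u w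

/-- A wire: a maximal connected subgraph consisting of wire-vertices only and
containing at least one edge, given by its (finite) set `s` of vertices. -/
def IsWireSet (H : SG NL WL NT EL) (s : Finset ℕ) : Prop :=
  s ⊆ H.verts ∧ (∀ v ∈ s, isWireL (H.lab v)) ∧
  (∃ e ∈ H.edges, e.1 ∈ s ∧ e.2.2 ∈ s) ∧
  (∀ u ∈ s, ∀ w ∈ s, Relation.ReflTransGen (fun a b => Adj H a b ∧ a ∈ s ∧ b ∈ s) u w) ∧
  (∀ u ∈ s, ∀ w, isWireL (H.lab w) → w ∈ H.verts → Adj H u w → w ∈ s)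

/-- A bare wire: a wire not connected to anything outside itself (in particular to
no node-vertex) and which is a chain rather than a circle. -/
def HasBareWire (D : SG NL WL NT EL) : Prop :=
  ∃ s, IsWireSet D s ∧
    (∀ e ∈ D.edges, ¬ (e.1 ∈ s ∧ e.2.2 ∉ s) ∧ ¬ (e.2.2 ∈ s ∧ e.1 ∉ s)) ∧
    (∃ v ∈ s, inDeg D v = 0 ∨ outDeg D v = 0)

/-- A connection instruction `(σ, β/γ, x, d)`. -/
structure ConnInstr (NL WL NT EL : Type) where
  src : VLab NL WL NT
  oldLab : EL
  newLab : EL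
  target : ℕ
  dirIn : Bool

/-- A production `X → (D, C)` of an edNCE grammar. -/
structure Production (NL WL NT EL : Type) where
  lhs : NT
  body : SG NL WL NT EL
  conn : List (ConnInstr NL WL NT EL)

/-- An edNCE grammar (with all vertex labels in `NL ⊕ WL` terminal and all edge
labels final, as assumed throughout the paper). -/
structure Grammar (NL WL NT EL : Type) where
  prods : List (Production NL WL NT EL)
  start : NT

/-- The initial graph: a single vertex labelled by the initial non-terminal. -/
def startGraph (S : NT) : SG NL WL NT EL where
  verts := {0}
  edges := ∅
  lab := fun _ => .inr S
  edge_src := by simp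
  edge_tgt := by simp
  no_loop := by simp

/-- One derivation step: the non-terminal vertex `v` is replaced by (a fresh copy,
via the injection `f`, of) the body of the `i`-th production, with bridge edges
installed according to the connection instructions. -/
def StepWith (G : Grammar NL WL NT EL) (H : SG NL WL NT EL) (v i : ℕ) (f : ℕ → ℕ)
    (H' : SG NL WL NT EL) : Prop :=
  ∃ p, G.prods[i]? = some p ∧ v ∈ H.verts ∧ H.lab v = .inr p.lhs ∧
    Set.InjOn f (p.body.verts : Set ℕ) ∧ (∀ w ∈ p.body.verts, f w ∉ H.verts) ∧
    H'.verts = H.verts.erase v ∪ p.body.verts.image f ∧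
    (∀ w ∈ H.verts.erase v, H'.lab w = H.lab w) ∧
    (∀ w ∈ p.body.verts, H'.lab (f w) = p.body.lab w) ∧
    (∀ e, e ∈ H'.edges ↔
      (e ∈ H.edges ∧ e.1 ≠ v ∧ e.2.2 ≠ v) ∨
      (∃ d ∈ p.body.edges, e = (f d.1, d.2.1, f d.2.2)) ∨
      (∃ c ∈ p.conn, c.target ∈ p.body.verts ∧
        ((c.dirIn = true ∧ ∃ w, (w, c.oldLab, v) ∈ H.edges ∧ H.lab w = c.src ∧
            e = (w, c.newLab, f c.target)) ∨
         (c.dirIn = false ∧ ∃ w, (v, c.oldLab, w) ∈ H.edges ∧ H.lab w = c.src ∧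
            e = (f c.target, c.newLab, w)))))

/-- A derivation recording its sequence of steps `(v, i, f)`. -/
inductive DerivesSeq (G : Grammar NL WL NT EL) :
    SG NL WL NT EL → List (ℕ × ℕ × (ℕ → ℕ)) → SG NL WL NT EL → Prop
  | refl (H : SG NL WL NT EL) : DerivesSeq G H [] H
  | step {H K H' : SG NL WL NT EL} {v i : ℕ} {f : ℕ → ℕ} {steps} :
      StepWith G H v i f K → DerivesSeq G K steps H' →
      DerivesSeq G H ((v, i, f) :: steps) H'

def Deriv (G : Grammar NL WL NT EL) (H H' : SG NL WL NT EL) : Prop :=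
  ∃ steps, DerivesSeq G H steps H'

/-- A decoding rule: a replacement graph `rhs` with two distinguished glueing
vertices `a` and `b` (the invariant node-vertices of the DPO rule). -/
structure DecRule (NL WL NT EL : Type) where
  rhs : SG NL WL NT EL
  a : ℕ
  b : ℕ

def NoEncEdges (enc : Finset EL) (H : SG NL WL NT EL) : Prop :=
  ∀ e ∈ H.edges, e.2.1 ∉ enc

/-- A decoding system: one DPO rule per triple `(α, N₁, N₂)` with `α ∈ enc`, whose
RHS is a connected string graph with no inputs, no outputs and no encoding labels,
glued along its two distinguished node-vertices labelled `N₁` and `N₂`. -/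
def IsDecodingSystem (enc : Finset EL) (T : EL → NL → NL → DecRule NL WL NT EL) : Prop :=
  ∀ α ∈ enc, ∀ N₁ N₂ : NL,
    IsStringGraph (T α N₁ N₂).rhs ∧ ConnectedG (T α N₁ N₂).rhs ∧
    (T α N₁ N₂).a ∈ (T α N₁ N₂).rhs.verts ∧ (T α N₁ N₂).b ∈ (T α N₁ N₂).rhs.verts ∧
    (T α N₁ N₂).a ≠ (T α N₁ N₂).b ∧
    (T α N₁ N₂).rhs.lab (T α N₁ N₂).a = .inl (.inl N₁) ∧
    (T α N₁ N₂).rhs.lab (T α N₁ N₂).b = .inl (.inl N₂) ∧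
    Inputs (T α N₁ N₂).rhs = ∅ ∧ Outputs (T α N₁ N₂).rhs = ∅ ∧
    NoEncEdges enc (T α N₁ N₂).rhs

/-- One decoding step: an encoding edge `(u, α, w)` between node-vertices is
replaced (DPO-style) by a fresh copy of the corresponding RHS, glued at `u, w`. -/
def DecStep (enc : Finset EL) (T : EL → NL → NL → DecRule NL WL NT EL)
    (H H' : SG NL WL NT EL) : Prop :=
  ∃ u α w N₁ N₂, ∃ f : ℕ → ℕ,
    (u, α, w) ∈ H.edges ∧ α ∈ enc ∧
    H.lab u = .inl (.inl N₁) ∧ H.lab w = .inl (.inl N₂) ∧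
    f (T α N₁ N₂).a = u ∧ f (T α N₁ N₂).b = w ∧
    Set.InjOn f ((T α N₁ N₂).rhs.verts : Set ℕ) ∧
    (∀ x ∈ (T α N₁ N₂).rhs.verts, x ≠ (T α N₁ N₂).a → x ≠ (T α N₁ N₂).b → f x ∉ H.verts) ∧
    H'.verts = H.verts ∪ (T α N₁ N₂).rhs.verts.image f ∧
    (∀ x ∈ H.verts, H'.lab x = H.lab x) ∧
    (∀ x ∈ (T α N₁ N₂).rhs.verts, H'.lab (f x) = (T α N₁ N₂).rhs.lab x) ∧
    (∀ e, e ∈ H'.edges ↔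
      (e ∈ H.edges ∧ e ≠ (u, α, w)) ∨
      ∃ d ∈ (T α N₁ N₂).rhs.edges, e = (f d.1, d.2.1, f d.2.2))

/-- A B-ESG grammar datum: a grammar together with encoding symbols and a
decoding system. -/
structure BESG (NL WL NT EL : Type) where
  G : Grammar NL WL NT EL
  enc : Finset EL
  T : EL → NL → NL → DecRule NL WL NT EL

/-- The boundary (B-edNCE) conditions and conditions N1, N2, W1–W4 for a single
production, relative to the whole grammar (for W4). -/
def CondsNW (enc : Finset EL) (G : Grammar NL WL NT EL) (p : Production NL WL NT EL) : Prop :=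
  -- B-edNCE: no adjacent non-terminals in the body
  (∀ e ∈ p.body.edges, ¬ (isNTL (p.body.lab e.1) ∧ isNTL (p.body.lab e.2.2))) ∧
  -- B-edNCE: no connection instruction with non-terminal source label
  (∀ c ∈ p.conn, ¬ isNTL c.src) ∧
  -- N1: an edge carries an encoding label iff it connects two node-vertices
  (∀ e ∈ p.body.edges,
    (e.2.1 ∈ enc ↔ (isNodeL (p.body.lab e.1) ∧ isNodeL (p.body.lab e.2.2)))) ∧
  -- N2: instructions targeting a node-vertex from a node label produce encoding labels
  (∀ c ∈ p.conn, isNodeL c.src → c.target ∈ p.body.verts →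
    isNodeL (p.body.lab c.target) → c.newLab ∈ enc) ∧
  -- W1: wire-vertices in the body have in- and out-degree at most one
  (∀ v ∈ p.body.verts, isWireL (p.body.lab v) → inDeg p.body v ≤ 1 ∧ outDeg p.body v ≤ 1) ∧
  -- W2: no connection instruction targets a wire-vertex
  (∀ c ∈ p.conn, c.target ∈ p.body.verts → ¬ isWireL (p.body.lab c.target)) ∧
  -- W3: at most one instruction per wire label, edge label and direction, non-encoding
  (∀ c ∈ p.conn, ∀ c' ∈ p.conn, isWireL c.src → c.src = c'.src →
    c.oldLab = c'.oldLab → c.dirIn = c'.dirIn → c = c') ∧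
  (∀ c ∈ p.conn, isWireL c.src → c.newLab ∉ enc) ∧
  -- W4: wires attached (directly or by instruction) to a non-terminal are matched
  -- by an instruction in every production for that non-terminal
  (∀ y ∈ p.body.verts, ∀ Y : NT, p.body.lab y = .inr Y →
    ∀ (Wl : WL) (β : EL) (d : Bool),
      ((d = true ∧ ∃ x ∈ p.body.verts, p.body.lab x = .inl (.inr Wl) ∧ (x, β, y) ∈ p.body.edges) ∨
       (d = false ∧ ∃ x ∈ p.body.verts, p.body.lab x = .inl (.inr Wl) ∧ (y, β, x) ∈ p.body.edges) ∨
       (∃ c ∈ p.conn, c.src = .inl (.inr Wl) ∧ c.newLab = β ∧ c.target = y ∧ c.dirIn = d)) →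
      ∀ p' ∈ G.prods, p'.lhs = Y →
        ∃ c ∈ p'.conn, c.src = .inl (.inr Wl) ∧ c.oldLab = β ∧ c.dirIn = d)

/-- `B` is a B-ESG grammar. -/
def IsBESG (B : BESG NL WL NT EL) : Prop :=
  IsDecodingSystem B.enc B.T ∧ ∀ p ∈ B.G.prods, CondsNW B.enc B.G p

/-- A concrete derivation `S ⟹* H₁ ⟹*_T F` of the B-ESG grammar `B`. -/
def ConcreteDeriv (B : BESG NL WL NT EL) (F : SG NL WL NT EL) : Prop :=
  ∃ H₁, Deriv B.G (startGraph B.G.start) H₁ ∧ NoNT H₁ ∧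
    Relation.ReflTransGen (DecStep B.enc B.T) H₁ F ∧ NoEncEdges B.enc F

/-- The language of a B-ESG grammar. -/
def Lang (B : BESG NL WL NT EL) : Set (SG NL WL NT EL) := {F | ConcreteDeriv B F}

/-- Graph isomorphism. -/
def Iso (H K : SG NL WL NT EL) : Prop :=
  ∃ φ : ℕ → ℕ, Set.BijOn φ (H.verts : Set ℕ) (K.verts : Set ℕ) ∧
    (∀ v ∈ H.verts, K.lab (φ v) = H.lab v) ∧
    (∀ e ∈ H.edges, (φ e.1, e.2.1, φ e.2.2) ∈ K.edges) ∧
    (∀ e ∈ K.edges, ∃ d ∈ H.edges, e = (φ d.1, d.2.1, φ d.2.2))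

/-- Merging two adjacent wire-vertices `u, v` (of the same wire label) into `u`. -/
def MergeStep (H H' : SG NL WL NT EL) : Prop :=
  ∃ u β v, (u, β, v) ∈ H.edges ∧ u ∈ H.verts ∧ v ∈ H.verts ∧
    isWireL (H.lab u) ∧ isWireL (H.lab v) ∧ H.lab u = H.lab v ∧
    (∀ γ, (v, γ, u) ∉ H.edges) ∧
    H'.verts = H.verts.erase v ∧
    (∀ x ∈ H.verts.erase v, H'.lab x = H.lab x) ∧
    (∀ e, e ∈ H'.edges ↔
      (e ∈ H.edges ∧ e.1 ≠ v ∧ e.2.2 ≠ v) ∨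
      (∃ γ x, (v, γ, x) ∈ H.edges ∧ e = (u, γ, x)))

/-- Wire-homeomorphism: the equivalence closure of merging/splitting. -/
def WireHomeo (H H' : SG NL WL NT EL) : Prop :=
  Relation.EqvGen (MergeStep (NL := NL) (WL := WL) (NT := NT) (EL := EL)) H H'

/-- A matching of `L` into `H`: an injective label-preserving homomorphism such
that the only edges incident to the image of `L` are incident to the image of
the boundary of `L`. -/
def IsMatching (L : SG NL WL NT EL) (m : ℕ → ℕ) (H : SG NL WL NT EL) : Prop :=
  Set.InjOn m (L.verts : Set ℕ) ∧ (∀ v ∈ L.verts, m v ∈ H.verts) ∧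
  (∀ v ∈ L.verts, H.lab (m v) = L.lab v) ∧
  (∀ e ∈ L.edges, (m e.1, e.2.1, m e.2.2) ∈ H.edges) ∧
  (∀ e ∈ H.edges,
    (e.1 ∈ L.verts.image m ∧ e.2.2 ∉ L.verts.image m → e.1 ∈ (Boundary L).image m) ∧
    (e.2.2 ∈ L.verts.image m ∧ e.1 ∉ L.verts.image m → e.2.2 ∈ (Boundary L).image m))

/-- `L` matches onto `H` up to wire-homeomorphism. -/
def MatchesModHomeo (L H : SG NL WL NT EL) : Prop :=
  ∃ Ht m, WireHomeo H Ht ∧ IsMatching L m Ht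

/-- A string graph rewrite rule `L ← B → R`, where the common boundary is shared
by name. -/
def IsSGRule (L R : SG NL WL NT EL) : Prop :=
  IsStringGraph L ∧ IsStringGraph R ∧
  Inputs L = Inputs R ∧ Outputs L = Outputs R ∧
  (∀ v ∈ Boundary L, R.lab v = L.lab v)

/-- Double-pushout rewriting of `G` at the matching `m` of `Lr`, glueing in a
fresh copy (via `g`) of `Rr` along the boundary. -/
def RewriteWith (Lr Rr : SG NL WL NT EL) (G : SG NL WL NT EL) (m g : ℕ → ℕ)
    (G' : SG NL WL NT EL) : Prop :=
  IsMatching Lr m G ∧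
  (∀ v ∈ Boundary Lr, g v = m v) ∧
  Set.InjOn g (Rr.verts : Set ℕ) ∧
  (∀ v ∈ Rr.verts, v ∉ Boundary Lr → g v ∉ G.verts) ∧
  G'.verts = (G.verts \ (Lr.verts \ Boundary Lr).image m) ∪ Rr.verts.image g ∧
  (∀ v ∈ G.verts, v ∉ (Lr.verts \ Boundary Lr).image m → G'.lab v = G.lab v) ∧
  (∀ v ∈ Rr.verts, G'.lab (g v) = Rr.lab v) ∧
  (∀ e, e ∈ G'.edges ↔
    (e ∈ G.edges ∧ (∀ d ∈ Lr.edges, e ≠ (m d.1, d.2.1, m d.2.2)) ∧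
      e.1 ∉ (Lr.verts \ Boundary Lr).image m ∧ e.2.2 ∉ (Lr.verts \ Boundary Lr).image m) ∨
    (∃ d ∈ Rr.edges, e = (g d.1, d.2.1, g d.2.2)))

/-- Rewriting `G` to `G'` with the rule `Lr ← B → Rr` at some matching. -/
def RewriteRel (Lr Rr : SG NL WL NT EL) (G G' : SG NL WL NT EL) : Prop :=
  ∃ m g, RewriteWith Lr Rr G m g G'

/-- Rewriting modulo wire-homeomorphism. -/
def SGRewrite (Lr Rr : SG NL WL NT EL) (G G' : SG NL WL NT EL) : Prop :=
  ∃ Gt, WireHomeo G Gt ∧ RewriteRel Lr Rr Gt G'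

/-- `n`-fold composition of a relation. -/
def RelPow {α : Type*} (r : α → α → Prop) : ℕ → α → α → Prop
  | 0, a, b => a = b
  | n + 1, a, b => ∃ c, r a c ∧ RelPow r n c b

/-- A final subgraph of a production body: a string-graph subgraph not adjacent to
any non-terminal and whose vertices occur in no connection instruction. -/
def IsFinalSub (p : Production NL WL NT EL) (s : Finset ℕ) : Prop :=
  s ⊆ p.body.verts ∧
  (∀ v ∈ s, ¬ isNTL (p.body.lab v)) ∧
  (∀ e ∈ p.body.edges, e.1 ∈ s → e.2.2 ∈ s →
    ¬ (isNodeL (p.body.lab e.1) ∧ isNodeL (p.body.lab e.2.2))) ∧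
  (∀ e ∈ p.body.edges, (e.1 ∈ s → ¬ isNTL (p.body.lab e.2.2)) ∧
    (e.2.2 ∈ s → ¬ isNTL (p.body.lab e.1))) ∧
  (∀ c ∈ p.conn, c.target ∉ s)

/-- A B-ESG transformation step: production `i` of `B` has its body rewritten by
the string graph rewrite rule `Lr ← B → Rr` at a matching into a final subgraph;
everything else is unchanged. -/
def TransformStepAt (B : BESG NL WL NT EL) (Lr Rr : SG NL WL NT EL) (i : ℕ)
    (B' : BESG NL WL NT EL) : Prop :=
  B'.enc = B.enc ∧ B'.T = B.T ∧ B'.G.start = B.G.start ∧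
  ∃ p p', B.G.prods[i]? = some p ∧
    B'.G.prods = B.G.prods.set i p' ∧
    p'.lhs = p.lhs ∧ p'.conn = p.conn ∧
    ∃ s m g, IsFinalSub p s ∧ (∀ v ∈ Lr.verts, m v ∈ s) ∧
      RewriteWith Lr Rr p.body m g p'.body

/-- A B-ESG rewrite pattern `(B₁, B₂)`: same decoding system, same initial
non-terminal, and a production-wise correspondence satisfying NT and IO (with
corresponding non-terminals, inputs and outputs identified by sharing names). -/
def IsRewritePattern (B₁ B₂ : BESG NL WL NT EL) : Prop :=
  IsBESG B₁ ∧ IsBESG B₂ ∧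
  B₁.enc = B₂.enc ∧ B₁.T = B₂.T ∧ B₁.G.start = B₂.G.start ∧
  B₁.G.prods.length = B₂.G.prods.length ∧
  ∀ (i : ℕ) (p₁ p₂ : Production NL WL NT EL),
    B₁.G.prods[i]? = some p₁ → B₂.G.prods[i]? = some p₂ →
    p₁.lhs = p₂.lhs ∧
    NTVerts p₁.body = NTVerts p₂.body ∧
    (∀ v ∈ NTVerts p₁.body, p₁.body.lab v = p₂.body.lab v) ∧
    Inputs p₁.body = Inputs p₂.body ∧ Outputs p₁.body = Outputs p₂.body

/-- A pattern instantiation: identical derivation sequences in `B₁` and `B₂`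
(applying corresponding productions at corresponding non-terminals), followed by
decoding, producing the rule `F ← B → F'`. -/
def Instantiates (B₁ B₂ : BESG NL WL NT EL) (F F' : SG NL WL NT EL) : Prop :=
  ∃ steps H₁ H₁',
    DerivesSeq B₁.G (startGraph B₁.G.start) steps H₁ ∧ NoNT H₁ ∧
    Relation.ReflTransGen (DecStep B₁.enc B₁.T) H₁ F ∧ NoEncEdges B₁.enc F ∧
    DerivesSeq B₂.G (startGraph B₂.G.start) steps H₁' ∧ NoNT H₁' ∧
    Relation.ReflTransGen (DecStep B₂.enc B₂.T) H₁' F' ∧ NoEncEdges B₂.enc F'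

/-- Match-exhaustive B-ESG grammar (Definition: bare-wire productions are
boundedly expandable; no isolated wire-vertices; no empty productions; no
single-non-terminal productions). -/
def MatchExhaustive (B : BESG NL WL NT EL) : Prop :=
  (∀ i p, B.G.prods[i]? = some p → HasBareWire p.body →
    ∃ N, ∀ steps K, DerivesSeq B.G (startGraph B.G.start) steps K →
      steps.countP (fun st => st.2.1 == i) ≤ N) ∧
  (∀ p ∈ B.G.prods, ∀ v ∈ p.body.verts, isWireL (p.body.lab v) →
    0 < inDeg p.body v + outDeg p.body v) ∧
  (∀ p ∈ B.G.prods, p.body.verts.Nonempty) ∧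
  (∀ p ∈ B.G.prods, ¬ ∃ v, p.body.verts = {v} ∧ isNTL (p.body.lab v))

/-- ESG-form: an encoded string graph possibly with extra non-terminals, attached
so that node-node edges are encoding edges, encoding edges avoid wire-vertices,
and wire-vertices keep in-degree and out-degree at most one. -/
def IsESGForm (enc : Finset EL) (H : SG NL WL NT EL) : Prop :=
  (∀ e ∈ H.edges, isNodeL (H.lab e.1) → isNodeL (H.lab e.2.2) → e.2.1 ∈ enc) ∧
  (∀ e ∈ H.edges, e.2.1 ∈ enc → ¬ isWireL (H.lab e.1) ∧ ¬ isWireL (H.lab e.2.2)) ∧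
  (∀ v ∈ H.verts, isWireL (H.lab v) → inDeg H v ≤ 1 ∧ outDeg H v ≤ 1)


/-- The invariant of B-ESG derivations: edges between node-vertices carry encoding labels, and
each wire-vertex has at most one outgoing and at most one incoming edge. -/
structure WireUnique (enc : Finset EL) (H : SG NL WL NT EL) : Prop where
  node_edge : ∀ e ∈ H.edges, isNodeL (H.lab e.1) → isNodeL (H.lab e.2.2) → e.2.1 ∈ enc
  out_unique : ∀ e ∈ H.edges, ∀ e' ∈ H.edges, isWireL (H.lab e.1) → e.1 = e'.1 → e = e'
  in_unique : ∀ e ∈ H.edges, ∀ e' ∈ H.edges, isWireL (H.lab e.2.2) → e.2.2 = e'.2.2 → e = e'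

lemma out_edge_unique {H : SG NL WL NT EL}
    (h : ∀ v ∈ H.verts, isWireL (H.lab v) → inDeg H v ≤ 1 ∧ outDeg H v ≤ 1) :
    ∀ e ∈ H.edges, ∀ e' ∈ H.edges, isWireL (H.lab e.1) → e.1 = e'.1 → e = e' := by
  intro e he e' he' hw heq
  exact Finset.card_le_one.1 (h e.1 (H.edge_src e he) hw).2 e (by simp [he]) e'
    (by simp [he', heq])

lemma in_edge_unique {H : SG NL WL NT EL}
    (h : ∀ v ∈ H.verts, isWireL (H.lab v) → inDeg H v ≤ 1 ∧ outDeg H v ≤ 1) :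
    ∀ e ∈ H.edges, ∀ e' ∈ H.edges, isWireL (H.lab e.2.2) → e.2.2 = e'.2.2 → e = e' := by
  intro e he e' he' hw heq
  exact Finset.card_le_one.1 (h e.2.2 (H.edge_tgt e he) hw).1 e (by simp [he]) e'
    (by simp [he', heq])

lemma WireUnique.degree_le_one {enc : Finset EL} {H : SG NL WL NT EL} (h : WireUnique enc H)
    (v : ℕ) (hw : isWireL (H.lab v)) : inDeg H v ≤ 1 ∧ outDeg H v ≤ 1 := by
  constructor
  · refine Finset.card_le_one.2 fun e he e' he' => ?_
    simp only [Finset.mem_filter] at he he'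
    exact h.in_unique e he.1 e' he'.1 (by rw [he.2]; exact hw) (he.2.trans he'.2.symm)
  · refine Finset.card_le_one.2 fun e he e' he' => ?_
    simp only [Finset.mem_filter] at he he'
    exact h.out_unique e he.1 e' he'.1 (by rw [he.2]; exact hw) (he.2.trans he'.2.symm)

lemma wireUnique_startGraph (enc : Finset EL) (S : NT) :
    WireUnique enc (startGraph S : SG NL WL NT EL) :=
  ⟨by simp [startGraph], by simp [startGraph], by simp [startGraph]⟩

lemma WireUnique.stepWith {G : Grammar NL WL NT EL} {enc : Finset EL}
    (hG : ∀ p ∈ G.prods, CondsNW enc G p) {H K : SG NL WL NT EL} {v i : ℕ} {f : ℕ → ℕ}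
    (hH : WireUnique enc H) (hs : StepWith G H v i f K) : WireUnique enc K := by
  obtain ⟨p, hp, -, -, hinj, hfresh, -, hlab, hlab', hedge⟩ := hs
  obtain ⟨-, -, hN1, hN2, hW1, hW2, hW3, -, -⟩ := hG p (List.mem_of_getElem? hp)
  have hsrc : ∀ {x γ y}, (x, γ, y) ∈ H.edges → x ∈ H.verts := fun h => H.edge_src _ h
  have htgt : ∀ {x γ y}, (x, γ, y) ∈ H.edges → y ∈ H.verts := fun h => H.edge_tgt _ h
  have hloop : ∀ {x γ y}, (x, γ, y) ∈ H.edges → x ≠ y := fun h => H.no_loop _ h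
  have hsrc' : ∀ {x γ y}, (x, γ, y) ∈ p.body.edges → x ∈ p.body.verts :=
    fun h => p.body.edge_src _ h
  have htgt' : ∀ {x γ y}, (x, γ, y) ∈ p.body.edges → y ∈ p.body.verts :=
    fun h => p.body.edge_tgt _ h
  have hinj' : ∀ x ∈ p.body.verts, ∀ y ∈ p.body.verts, f x = f y → x = y :=
    fun x hx y hy h => hinj hx hy h
  have hbo := out_edge_unique hW1
  have hbi := in_edge_unique hW1
  obtain ⟨hn, ho, hi⟩ := hH
  have hlab_old : ∀ w ∈ H.verts, w ≠ v → K.lab w = H.lab w :=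
    fun w hw hne => hlab w (Finset.mem_erase.2 ⟨hne, hw⟩)
  simp only [Prod.forall] at hN1 hbo hbi hn ho hi
  clear hG hp hinj hlab hW1
  refine ⟨?_, ?_, ?_⟩
  · rintro ⟨a, γ, b⟩ he h1 h2
    rcases (hedge _).1 he with ⟨he, hs, ht⟩ | ⟨⟨x, δ, y⟩, hd, heq⟩ |
      ⟨c, hc, hct, ⟨hdir, w, hw, hl, heq⟩ | ⟨hdir, w, hw, hl, heq⟩⟩ <;>
    clear hedge <;> grind
  · rintro ⟨a, γ, b⟩ he ⟨a', γ', b'⟩ he' h1 h2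
    rcases (hedge _).1 he with ⟨he, hs, ht⟩ | ⟨⟨x, δ, y⟩, hd, heq⟩ |
      ⟨c, hc, hct, ⟨hdir, w, hw, hl, heq⟩ | ⟨hdir, w, hw, hl, heq⟩⟩ <;>
    rcases (hedge _).1 he' with ⟨he', hs', ht'⟩ | ⟨⟨x', δ', y'⟩, hd', heq'⟩ |
      ⟨c', hc', hct', ⟨hdir', w', hw', hl', heq'⟩ | ⟨hdir', w', hw', hl', heq'⟩⟩ <;>
    clear hedge <;> grind
  · rintro ⟨a, γ, b⟩ he ⟨a', γ', b'⟩ he' h1 h2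
    rcases (hedge _).1 he with ⟨he, hs, ht⟩ | ⟨⟨x, δ, y⟩, hd, heq⟩ |
      ⟨c, hc, hct, ⟨hdir, w, hw, hl, heq⟩ | ⟨hdir, w, hw, hl, heq⟩⟩ <;>
    rcases (hedge _).1 he' with ⟨he', hs', ht'⟩ | ⟨⟨x', δ', y'⟩, hd', heq'⟩ |
      ⟨c', hc', hct', ⟨hdir', w', hw', hl', heq'⟩ | ⟨hdir', w', hw', hl', heq'⟩⟩ <;>
    clear hedge <;> grind

lemma WireUnique.derivesSeq {G : Grammar NL WL NT EL} {enc : Finset EL}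
    (hG : ∀ p ∈ G.prods, CondsNW enc G p) {H K : SG NL WL NT EL} {steps}
    (hd : DerivesSeq G H steps K) (hH : WireUnique enc H) : WireUnique enc K := by
  induction hd with
  | refl => exact hH
  | step hs _ ih => exact ih (hH.stepWith hG hs)

lemma NoNT.decStep {enc : Finset EL} {T : EL → NL → NL → DecRule NL WL NT EL}
    (hT : IsDecodingSystem enc T) {H K : SG NL WL NT EL} (hH : NoNT H)
    (hs : DecStep enc T H K) : NoNT K := by
  obtain ⟨u, α, w, N₁, N₂, f, -, hα, -, -, -, -, -, -, hverts, hlab, hlab', -⟩ := hs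
  have hR := (hT α hα N₁ N₂).1.1
  intro x hx
  rw [hverts, Finset.mem_union, Finset.mem_image] at hx
  rcases hx with hx | ⟨y, hy, rfl⟩
  · rw [hlab x hx]
    exact hH x hx
  · rw [hlab' y hy]
    exact hR y hy

lemma WireUnique.decStep {enc : Finset EL} {T : EL → NL → NL → DecRule NL WL NT EL}
    (hT : IsDecodingSystem enc T) {H K : SG NL WL NT EL} (hH : WireUnique enc H)
    (hs : DecStep enc T H K) : WireUnique enc K := by
  obtain ⟨u, α, w, N₁, N₂, f, -, hα, -, -, -, -, hinj, hfresh, -, hlab, hlab', hedge⟩ := hs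
  obtain ⟨⟨-, hR, hW⟩, -, -, -, -, hla, hlb, -⟩ := hT α hα N₁ N₂
  generalize T α N₁ N₂ = R at *
  have hsrc := H.edge_src
  have htgt := H.edge_tgt
  have hsrc' := R.rhs.edge_src
  have htgt' := R.rhs.edge_tgt
  have hinj' : ∀ x ∈ R.rhs.verts, ∀ y ∈ R.rhs.verts, f x = f y → x = y :=
    fun x hx y hy h => hinj hx hy h
  have hfresh' : ∀ x ∈ R.rhs.verts, isWireL (R.rhs.lab x) → f x ∉ H.verts := by
    intro x hx hw
    refine hfresh x hx ?_ ?_ <;> rintro rfl <;> simp_all [isWireL]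
  have hbo := out_edge_unique hW
  have hbi := in_edge_unique hW
  obtain ⟨hn, ho, hi⟩ := hH
  clear hinj hfresh hla hlb hW
  refine ⟨?_, ?_, ?_⟩
  · intro e he h1 h2
    rcases (hedge e).1 he with ⟨he, -⟩ | ⟨d, hd, rfl⟩ <;> grind
  · intro e he e' he' h1 h2
    rcases (hedge e).1 he with ⟨he, -⟩ | ⟨d, hd, rfl⟩ <;>
    rcases (hedge e').1 he' with ⟨he', -⟩ | ⟨d', hd', rfl⟩ <;> grind
  · intro e he e' he' h1 h2
    rcases (hedge e).1 he with ⟨he, -⟩ | ⟨d, hd, rfl⟩ <;>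
    rcases (hedge e').1 he' with ⟨he', -⟩ | ⟨d', hd', rfl⟩ <;> grind

/-- Theorem 1 of the paper: every graph in the language of a
B-ESG grammar is a string graph. -/
theorem besg_language_consists_of_string_graphs
    {NL WL NT EL : Type} (B : BESG NL WL NT EL) (hB : IsBESG B) :
    ∀ F ∈ Lang B, IsStringGraph F := by
  rintro F ⟨H₁, ⟨steps, hd⟩, hNT, hdec, henc⟩
  have hinv : NoNT F ∧ WireUnique B.enc F := by
    clear henc
    induction hdec with
    | refl => exact ⟨hNT, (wireUnique_startGraph B.enc B.G.start).derivesSeq hB.2 hd⟩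
    | tail _ hs ih => exact ⟨ih.1.decStep hB.1 hs, ih.2.decStep hB.1 hs⟩
  exact ⟨hinv.1, fun e he hnode => henc e he (hinv.2.node_edge e he hnode.1 hnode.2),
    fun v _ hw => hinv.2.degree_le_one v hw⟩

end BESG
end

section
/- For every B-ESG grammar B = (G,T) there exists n ∈ ℕ such that every graph H ∈ L(B) contains no wire of size greater than n. In particular, n can be taken to be the length of the longest wire occurring in the bodies of the productions of G and T. -/
set_option linter.dupNamespace false

namespace BESG

variable {NL WL NT EL : Type}

/-- A graph has wire classes of size at most `n` if its vertices can be coloured so that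
adjacent wire-vertices share a colour and every colour is used at most `n` times. -/
def HasWireColoring (n : ℕ) (H : SG NL WL NT EL) : Prop :=
  ∃ c : ℕ → ℕ,
    (∀ e ∈ H.edges, isWireL (H.lab e.1) → isWireL (H.lab e.2.2) → c e.1 = c e.2.2) ∧
    ∀ k, (H.verts.filter fun v => c v = k).card ≤ n

theorem HasWireColoring.card_le {n : ℕ} {H : SG NL WL NT EL} (h : HasWireColoring n H)
    {s : Finset ℕ} (hs : IsWireSet H s) : s.card ≤ n := by
  obtain ⟨c, hc, hn⟩ := h
  obtain ⟨hsub, hw, ⟨e, -, he, -⟩, hconn, -⟩ := hs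
  refine (Finset.card_le_card fun v hv => ?_).trans (hn (c e.1))
  refine Finset.mem_filter.2 ⟨hsub hv, ?_⟩
  induction hconn e.1 he v hv with
  | refl => rfl
  | tail _ hbc ih =>
    obtain ⟨⟨γ, hγ⟩, hb, hv'⟩ := hbc
    rw [← ih hb]
    rcases hγ with hγ | hγ
    · exact (hc _ hγ (hw _ hb) (hw _ hv')).symm
    · exact hc _ hγ (hw _ hv') (hw _ hb)

theorem hasWireColoring_startGraph {n : ℕ} (hn : 1 ≤ n) (S : NT) :
    HasWireColoring n (startGraph S : SG NL WL NT EL) :=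
  ⟨fun _ => 0, by simp [startGraph], fun _ =>
    (Finset.card_le_card (Finset.filter_subset _ _)).trans (by simpa [startGraph] using hn)⟩

/-- Adding at most `n` new vertices which are not wire-adjacent to old ones preserves the
colouring bound: give all new vertices one fresh colour. -/
theorem HasWireColoring.extend {n : ℕ} {H H' : SG NL WL NT EL} (h : HasWireColoring n H)
    (A : Finset ℕ) (hA : A.card ≤ n) (hverts : H'.verts ⊆ H.verts ∪ A)
    (hedges : ∀ e ∈ H'.edges, isWireL (H'.lab e.1) → isWireL (H'.lab e.2.2) →
      (e ∈ H.edges ∧ isWireL (H.lab e.1) ∧ isWireL (H.lab e.2.2)) ∨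
      (e.1 ∉ H.verts ∧ e.2.2 ∉ H.verts)) :
    HasWireColoring n H' := by
  obtain ⟨c, hc, hn⟩ := h
  obtain ⟨k₀, hk₀⟩ := Infinite.exists_notMem_finset (H.verts.image c)
  refine ⟨fun v => if v ∈ H.verts then c v else k₀, fun e he h₁ h₂ => ?_, fun k => ?_⟩
  · rcases hedges e he h₁ h₂ with ⟨he', h₁', h₂'⟩ | ⟨h₁', h₂'⟩
    · simpa [H.edge_src e he', H.edge_tgt e he'] using hc e he' h₁' h₂'
    · simp [h₁', h₂']
  · by_cases hk : k = k₀
    · refine (Finset.card_le_card fun v hv => ?_).trans hA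
      obtain ⟨hv, hvk⟩ := Finset.mem_filter.1 hv
      dsimp only at hvk
      refine (Finset.mem_union.1 (hverts hv)).resolve_left fun hvH => hk₀ ?_
      rw [if_pos hvH, hk] at hvk
      exact hvk ▸ Finset.mem_image_of_mem c hvH
    · refine (Finset.card_le_card fun v hv => ?_).trans (hn k)
      obtain ⟨hv, hvk⟩ := Finset.mem_filter.1 hv
      dsimp only at hvk
      by_cases hvH : v ∈ H.verts
      · exact Finset.mem_filter.2 ⟨hvH, by simpa [hvH] using hvk⟩
      · rw [if_neg hvH] at hvk
        exact absurd hvk.symm hk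

theorem HasWireColoring.stepWith {n : ℕ} {G : Grammar NL WL NT EL}
    (hcard : ∀ p ∈ G.prods, p.body.verts.card ≤ n)
    (hW2 : ∀ p ∈ G.prods, ∀ c ∈ p.conn, c.target ∈ p.body.verts →
      ¬ isWireL (p.body.lab c.target))
    {H H' : SG NL WL NT EL} {v i : ℕ} {f : ℕ → ℕ} (h : HasWireColoring n H)
    (hstep : StepWith G H v i f H') : HasWireColoring n H' := by
  obtain ⟨p, hp, -, -, -, hfresh, hverts, hlab, hlab', hedges⟩ := hstep
  have hp : p ∈ G.prods := List.mem_of_getElem? hp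
  refine h.extend (p.body.verts.image f) (Finset.card_image_le.trans (hcard p hp)) ?_ ?_
  · rw [hverts]
    exact Finset.union_subset_union_left (Finset.erase_subset _ _)
  · intro e he h₁ h₂
    rcases (hedges e).1 he with
      ⟨he, hv₁, hv₂⟩ | ⟨d, hd, rfl⟩ | ⟨c, hc, hct, ⟨-, w, -, -, rfl⟩ | ⟨-, w, -, -, rfl⟩⟩
    · rw [hlab _ (Finset.mem_erase.2 ⟨hv₁, H.edge_src e he⟩)] at h₁
      rw [hlab _ (Finset.mem_erase.2 ⟨hv₂, H.edge_tgt e he⟩)] at h₂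
      exact .inl ⟨he, h₁, h₂⟩
    · exact .inr ⟨hfresh _ (p.body.edge_src d hd), hfresh _ (p.body.edge_tgt d hd)⟩
    · exact absurd (hlab' _ hct ▸ h₂) (hW2 p hp c hc hct)
    · exact absurd (hlab' _ hct ▸ h₁) (hW2 p hp c hc hct)

theorem HasWireColoring.derivesSeq {n : ℕ} {G : Grammar NL WL NT EL}
    (hcard : ∀ p ∈ G.prods, p.body.verts.card ≤ n)
    (hW2 : ∀ p ∈ G.prods, ∀ c ∈ p.conn, c.target ∈ p.body.verts →
      ¬ isWireL (p.body.lab c.target))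
    {H H' : SG NL WL NT EL} {steps : List (ℕ × ℕ × (ℕ → ℕ))} (h : HasWireColoring n H)
    (hder : DerivesSeq G H steps H') : HasWireColoring n H' := by
  induction hder with
  | refl => exact h
  | step hstep _ ih => exact ih (h.stepWith hcard hW2 hstep)

theorem HasWireColoring.decStep {n : ℕ} {enc : Finset EL}
    {T : EL → NL → NL → DecRule NL WL NT EL} (hT : IsDecodingSystem enc T)
    (hcard : ∀ α ∈ enc, ∀ N₁ N₂ : NL, (T α N₁ N₂).rhs.verts.card ≤ n)
    {H H' : SG NL WL NT EL} (h : HasWireColoring n H) (hstep : DecStep enc T H H') :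
    HasWireColoring n H' := by
  obtain ⟨u, α, w, N₁, N₂, f, -, hα, -, -, -, -, -, hfresh, hverts, hlab, hlab', hedges⟩ := hstep
  obtain ⟨-, -, -, -, -, ha, hb, -⟩ := hT α hα N₁ N₂
  have hnew : ∀ x ∈ (T α N₁ N₂).rhs.verts, isWireL (H'.lab (f x)) → f x ∉ H.verts := by
    intro x hx hwire
    rw [hlab' x hx] at hwire
    refine hfresh x hx ?_ ?_ <;> rintro rfl
    · simp [ha, isWireL] at hwire
    · simp [hb, isWireL] at hwire
  refine h.extend ((T α N₁ N₂).rhs.verts.image f)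
    (Finset.card_image_le.trans (hcard α hα N₁ N₂)) hverts.subset fun e he h₁ h₂ => ?_
  rcases (hedges e).1 he with ⟨he, -⟩ | ⟨d, hd, rfl⟩
  · rw [hlab _ (H.edge_src e he)] at h₁
    rw [hlab _ (H.edge_tgt e he)] at h₂
    exact .inl ⟨he, h₁, h₂⟩
  · exact .inr ⟨hnew _ ((T α N₁ N₂).rhs.edge_src d hd) h₁,
      hnew _ ((T α N₁ N₂).rhs.edge_tgt d hd) h₂⟩

theorem BESG.exists_card_verts_le [Fintype NL] (B : BESG NL WL NT EL) :
    ∃ n : ℕ, 1 ≤ n ∧ (∀ p ∈ B.G.prods, p.body.verts.card ≤ n) ∧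
      ∀ α ∈ B.enc, ∀ N₁ N₂ : NL, (B.T α N₁ N₂).rhs.verts.card ≤ n := by
  obtain ⟨a, ha⟩ := ((List.finite_toSet B.G.prods).image fun p => p.body.verts.card).bddAbove
  let S : Finset (EL × NL × NL) := B.enc ×ˢ Finset.univ
  let g : EL × NL × NL → ℕ := fun t => (B.T t.1 t.2.1 t.2.2).rhs.verts.card
  refine ⟨1 + a + S.sup g, by omega, fun p hp => ?_, fun α hα N₁ N₂ => ?_⟩
  · have : p.body.verts.card ≤ a := ha ⟨p, hp, rfl⟩
    omega
  · have : g (α, N₁, N₂) ≤ S.sup g := Finset.le_sup (by simp [S, hα])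
    exact this.trans (by omega)

/-- Lemma 2 of the paper: wires of graphs in the language of a
B-ESG grammar have bounded size; the bound can be taken to dominate all wires in
the bodies of the productions of `G` and of the decoding system `T`. -/
theorem besg_bounded_wire_length
    {NL WL NT EL : Type} [Fintype NL]
    (B : BESG NL WL NT EL) (hB : IsBESG B) :
    ∃ n : ℕ,
      (∀ p ∈ B.G.prods, ∀ s, IsWireSet p.body s → s.card ≤ n) ∧
      (∀ α ∈ B.enc, ∀ N₁ N₂ : NL, ∀ s, IsWireSet (B.T α N₁ N₂).rhs s → s.card ≤ n) ∧
      (∀ F ∈ Lang B, ∀ s, IsWireSet F s → s.card ≤ n) := by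
  obtain ⟨n, hn, hG, hT⟩ := B.exists_card_verts_le
  refine ⟨n, fun p hp s hs => (Finset.card_le_card hs.1).trans (hG p hp),
    fun α hα N₁ N₂ s hs => (Finset.card_le_card hs.1).trans (hT α hα N₁ N₂), ?_⟩
  rintro F ⟨H, ⟨steps, hder⟩, -, hdec, -⟩
  have hW2 : ∀ p ∈ B.G.prods, ∀ c ∈ p.conn, c.target ∈ p.body.verts →
      ¬ isWireL (p.body.lab c.target) := fun p hp => by
    obtain ⟨-, -, -, -, -, h, -⟩ := hB.2 p hp
    exact h
  have hF : HasWireColoring n F := by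
    induction hdec with
    | refl => exact (hasWireColoring_startGraph hn _).derivesSeq hG hW2 hder
    | tail _ hstep ih => exact ih.decStep hB.1 hT hstep
  exact fun s hs => hF.card_le hs

end BESG
end

section
/- Every decoding system T, viewed as a rewrite system on encoded string graphs, is confluent and terminating; consequently every encoded string graph has a unique T-normal form (its decoding), and this normal form contains no encoding edges. -/
set_option linter.dupNamespace false

namespace BESG

variable {NL WL NT EL : Type}

/-- The decoding rule that `T` prescribes for the edge `e` of `H`; if the endpoints of `e` are
not both node-vertices the value is irrelevant. -/
def ruleAt (T : EL → NL → NL → DecRule NL WL NT EL) (H : SG NL WL NT EL) (e : ℕ × EL × ℕ) :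
    DecRule NL WL NT EL :=
  match H.lab e.1, H.lab e.2.2 with
  | .inl (.inl N₁), .inl (.inl N₂) => T e.2.1 N₁ N₂
  | _, _ => ⟨H, 0, 0⟩

theorem ruleAt_eq (T : EL → NL → NL → DecRule NL WL NT EL) {H : SG NL WL NT EL}
    {e : ℕ × EL × ℕ} {N₁ N₂ : NL} (h₁ : H.lab e.1 = .inl (.inl N₁))
    (h₂ : H.lab e.2.2 = .inl (.inl N₂)) : ruleAt T H e = T e.2.1 N₁ N₂ := by
  simp [ruleAt, h₁, h₂]

/-- A vertex of the right-hand side of a rule which is not one of the two glueing vertices. -/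
def DecRule.Interior (r : DecRule NL WL NT EL) (x : ℕ) : Prop :=
  x ∈ r.rhs.verts ∧ x ≠ r.a ∧ x ≠ r.b

/-- `K` arises from `H` by replacing each edge `e ∈ S` by a fresh copy, via `g e`, of the
right-hand side of `R e`. -/
structure IsExpansion (R : ℕ × EL × ℕ → DecRule NL WL NT EL) (H : SG NL WL NT EL)
    (S : Set (ℕ × EL × ℕ)) (g : ℕ × EL × ℕ → ℕ → ℕ) (K : SG NL WL NT EL) : Prop where
  mem_edges : ∀ e ∈ S, e ∈ H.edges
  map_a : ∀ e ∈ S, g e (R e).a = e.1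
  map_b : ∀ e ∈ S, g e (R e).b = e.2.2
  fresh : ∀ e ∈ S, ∀ x, (R e).Interior x → g e x ∉ H.verts
  inj : ∀ e ∈ S, ∀ x, (R e).Interior x → ∀ e' ∈ S, ∀ x', (R e').Interior x' →
    g e x = g e' x' → e = e' ∧ x = x'
  verts : ∀ y, y ∈ K.verts ↔ y ∈ H.verts ∨ ∃ e ∈ S, ∃ x ∈ (R e).rhs.verts, y = g e x
  lab_old : ∀ y ∈ H.verts, K.lab y = H.lab y
  lab_new : ∀ e ∈ S, ∀ x ∈ (R e).rhs.verts, K.lab (g e x) = (R e).rhs.lab x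
  edges : ∀ e, e ∈ K.edges ↔ (e ∈ H.edges ∧ e ∉ S) ∨
    ∃ e' ∈ S, ∃ d ∈ (R e').rhs.edges, e = (g e' d.1, d.2.1, g e' d.2.2)

theorem IsExpansion.refl (R : ℕ × EL × ℕ → DecRule NL WL NT EL) (H : SG NL WL NT EL)
    (g : ℕ × EL × ℕ → ℕ → ℕ) : IsExpansion R H ∅ g H := by
  constructor <;> simp

section

variable {R : ℕ × EL × ℕ → DecRule NL WL NT EL} {H K K' : SG NL WL NT EL}
  {S : Set (ℕ × EL × ℕ)} {g g' : ℕ × EL × ℕ → ℕ → ℕ}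

theorem IsExpansion.exists_map (h : IsExpansion R H S g K) (h' : IsExpansion R H S g' K') :
    ∃ φ : ℕ → ℕ, (∀ y ∈ H.verts, φ y = y) ∧
      ∀ e ∈ S, ∀ x ∈ (R e).rhs.verts, φ (g e x) = g' e x := by
  classical
  let P : ℕ → (ℕ × EL × ℕ) × ℕ → Prop := fun y p =>
    p.1 ∈ S ∧ (R p.1).Interior p.2 ∧ y = g p.1 p.2
  let φ : ℕ → ℕ := fun y =>
    if y ∈ H.verts then y
    else if hy : ∃ p, P y p then g' hy.choose.1 hy.choose.2 else y
  have hφ : ∀ y ∈ H.verts, φ y = y := fun y hy => if_pos hy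
  refine ⟨φ, hφ, fun e he x hx => ?_⟩
  by_cases ha : x = (R e).a
  · rw [ha, h.map_a e he, h'.map_a e he]
    exact hφ _ (H.edge_src e (h.mem_edges e he))
  by_cases hb : x = (R e).b
  · rw [hb, h.map_b e he, h'.map_b e he]
    exact hφ _ (H.edge_tgt e (h.mem_edges e he))
  have hi : (R e).Interior x := ⟨hx, ha, hb⟩
  have hy : ∃ p, P (g e x) p := ⟨(e, x), he, hi, rfl⟩
  have hval : φ (g e x) = g' hy.choose.1 hy.choose.2 := by
    simp only [φ]
    rw [if_neg (h.fresh e he x hi), dif_pos hy]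
  obtain ⟨hS, hint, heq⟩ := hy.choose_spec
  obtain ⟨h₁, h₂⟩ := h.inj e he x hi _ hS _ hint heq
  rw [hval, ← h₁, ← h₂]

theorem IsExpansion.mapsTo {φ : ℕ → ℕ} (h : IsExpansion R H S g K)
    (h' : IsExpansion R H S g' K') (hφ : ∀ y ∈ H.verts, φ y = y)
    (hφg : ∀ e ∈ S, ∀ x ∈ (R e).rhs.verts, φ (g e x) = g' e x) :
    Set.MapsTo φ (K.verts : Set ℕ) (K'.verts : Set ℕ) := by
  intro y hy
  rw [Finset.mem_coe, h'.verts]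
  rcases (h.verts y).1 hy with hy | ⟨e, he, x, hx, rfl⟩
  · exact .inl (by rwa [hφ y hy])
  · exact .inr ⟨e, he, x, hx, hφg e he x hx⟩

theorem IsExpansion.leftInvOn {φ ψ : ℕ → ℕ} (h : IsExpansion R H S g K)
    (hφ : ∀ y ∈ H.verts, φ y = y)
    (hφg : ∀ e ∈ S, ∀ x ∈ (R e).rhs.verts, φ (g e x) = g' e x)
    (hψ : ∀ y ∈ H.verts, ψ y = y)
    (hψg : ∀ e ∈ S, ∀ x ∈ (R e).rhs.verts, ψ (g' e x) = g e x) :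
    Set.LeftInvOn ψ φ (K.verts : Set ℕ) := by
  intro y hy
  rcases (h.verts y).1 hy with hy | ⟨e, he, x, hx, rfl⟩
  · rw [hφ y hy, hψ y hy]
  · rw [hφg e he x hx, hψg e he x hx]

/-- Two expansions of the same graph along the same set of edges are isomorphic. -/
theorem IsExpansion.iso (h : IsExpansion R H S g K) (h' : IsExpansion R H S g' K') :
    Iso K K' := by
  obtain ⟨φ, hφ, hφg⟩ := h.exists_map h'
  obtain ⟨ψ, hψ, hψg⟩ := h'.exists_map h
  have hφe : ∀ e ∈ H.edges, (φ e.1, e.2.1, φ e.2.2) = e := fun e he => by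
    rw [hφ _ (H.edge_src e he), hφ _ (H.edge_tgt e he)]
  have hφd : ∀ e ∈ S, ∀ d ∈ (R e).rhs.edges,
      (φ (g e d.1), d.2.1, φ (g e d.2.2)) = (g' e d.1, d.2.1, g' e d.2.2) := fun e he d hd => by
    rw [hφg e he _ ((R e).rhs.edge_src d hd), hφg e he _ ((R e).rhs.edge_tgt d hd)]
  refine ⟨φ, Set.InvOn.bijOn
    ⟨h.leftInvOn hφ hφg hψ hψg, h'.leftInvOn hψ hψg hφ hφg⟩
    (h.mapsTo h' hφ hφg) (h'.mapsTo h hψ hψg), ?_, ?_, ?_⟩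
  · intro y hy
    rcases (h.verts y).1 hy with hy | ⟨e, he, x, hx, rfl⟩
    · rw [hφ y hy, h.lab_old y hy, h'.lab_old y hy]
    · rw [hφg e he x hx, h.lab_new e he x hx, h'.lab_new e he x hx]
  · intro e he
    rw [h'.edges]
    rcases (h.edges e).1 he with ⟨he, heS⟩ | ⟨e', he', d, hd, rfl⟩
    · exact .inl (by rw [hφe e he]; exact ⟨he, heS⟩)
    · exact .inr ⟨e', he', d, hd, hφd e' he' d hd⟩
  · intro e he
    rcases (h'.edges e).1 he with ⟨he, heS⟩ | ⟨e', he', d, hd, rfl⟩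
    · exact ⟨e, (h.edges e).2 (.inl ⟨he, heS⟩), (hφe e he).symm⟩
    · exact ⟨_, (h.edges _).2 (.inr ⟨e', he', d, hd, rfl⟩), (hφd e' he' d hd).symm⟩

end

section

variable {enc : Finset EL} {T : EL → NL → NL → DecRule NL WL NT EL} {H K K' : SG NL WL NT EL}
  {S : Set (ℕ × EL × ℕ)} {g : ℕ × EL × ℕ → ℕ → ℕ}

theorem IsDecodingSystem.noEncEdges (hT : IsDecodingSystem enc T) {α : EL} (hα : α ∈ enc)
    (N₁ N₂ : NL) : NoEncEdges enc (T α N₁ N₂).rhs :=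
  (hT α hα N₁ N₂).2.2.2.2.2.2.2.2.2

/-- The encoding edges of `H`. -/
def encEdges (enc : Finset EL) (H : SG NL WL NT EL) : Set (ℕ × EL × ℕ) :=
  {e | e ∈ H.edges ∧ e.2.1 ∈ enc}

theorem IsEncodedSG.exists_nodeLabels (hH : IsEncodedSG enc H) {e : ℕ × EL × ℕ}
    (he : e ∈ encEdges enc H) :
    ∃ N₁ N₂, H.lab e.1 = .inl (.inl N₁) ∧ H.lab e.2.2 = .inl (.inl N₂) := by
  obtain ⟨h₁, h₂⟩ := (hH.2.1 e he.1).2 he.2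
  have key : ∀ l : VLab NL WL NT, isNodeL l = true → ∃ N, l = .inl (.inl N) := by
    rintro ((N | W) | X) hl
    · exact ⟨N, rfl⟩
    · simp [isNodeL] at hl
    · simp [isNodeL] at hl
  obtain ⟨N₁, hN₁⟩ := key _ h₁
  obtain ⟨N₂, hN₂⟩ := key _ h₂
  exact ⟨N₁, N₂, hN₁, hN₂⟩

theorem IsExpansion.mem_encEdges_iff (hT : IsDecodingSystem enc T) (hH : IsEncodedSG enc H)
    (hS : S ⊆ encEdges enc H) (h : IsExpansion (ruleAt T H) H S g K) (e : ℕ × EL × ℕ) :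
    e ∈ encEdges enc K ↔ e ∈ encEdges enc H ∧ e ∉ S := by
  constructor
  · rintro ⟨he, hα⟩
    rcases (h.edges e).1 he with ⟨he, heS⟩ | ⟨e', he', d, hd, rfl⟩
    · exact ⟨⟨he, hα⟩, heS⟩
    · obtain ⟨N₁, N₂, h₁, h₂⟩ := hH.exists_nodeLabels (hS he')
      rw [ruleAt_eq T h₁ h₂] at hd
      exact absurd hα (hT.noEncEdges (hS he').2 N₁ N₂ d hd)
  · rintro ⟨⟨he, hα⟩, heS⟩
    exact ⟨(h.edges e).2 (.inl ⟨he, heS⟩), hα⟩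

theorem IsExpansion.decStep (hT : IsDecodingSystem enc T) (hH : IsEncodedSG enc H)
    (hS : S ⊆ encEdges enc H) (h : IsExpansion (ruleAt T H) H S g K)
    (hstep : DecStep enc T K K') :
    ∃ S' g', S' ⊆ encEdges enc H ∧ IsExpansion (ruleAt T H) H S' g' K' := by
  classical
  obtain ⟨u, α, w, N₁, N₂, f, huw, hα, hu, hw, hfa, hfb, hfinj, hfresh, hverts, hold, hnew,
    hedges⟩ := hstep
  obtain ⟨hE, heS⟩ := (h.mem_encEdges_iff hT hH hS (u, α, w)).1 ⟨huw, hα⟩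
  have hsrc : u ∈ H.verts := H.edge_src _ hE.1
  have htgt : w ∈ H.verts := H.edge_tgt _ hE.1
  rw [h.lab_old u hsrc] at hu
  rw [h.lab_old w htgt] at hw
  have hR : ruleAt T H (u, α, w) = T α N₁ N₂ := ruleAt_eq T hu hw
  rw [← hR] at hfa hfb hfinj hfresh hverts hnew hedges
  have hnoenc : ∀ e ∈ S, ∀ d ∈ (ruleAt T H e).rhs.edges,
      (g e d.1, d.2.1, g e d.2.2) ≠ (u, α, w) := fun e he d hd heq => by
    obtain ⟨M₁, M₂, h₁, h₂⟩ := hH.exists_nodeLabels (hS he)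
    rw [ruleAt_eq T h₁ h₂] at hd
    exact hT.noEncEdges (hS he).2 M₁ M₂ d hd (congrArg (·.2.1) heq ▸ hα)
  generalize ruleAt T H = R at *
  have hHK : ∀ y ∈ H.verts, y ∈ K.verts := fun y hy => (h.verts y).2 (.inl hy)
  have hgK : ∀ e ∈ S, ∀ x ∈ (R e).rhs.verts, g e x ∈ K.verts :=
    fun e he x hx => (h.verts _).2 (.inr ⟨e, he, x, hx, rfl⟩)
  have hself : Function.update g (u, α, w) f (u, α, w) = f := Function.update_self ..
  have hother : ∀ e ∈ S, Function.update g (u, α, w) f e = g e := fun e he =>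
    Function.update_of_ne (ne_of_mem_of_not_mem he heS) _ _
  refine ⟨insert (u, α, w) S, Function.update g (u, α, w) f,
    Set.insert_subset hE hS, ?_⟩
  constructor
  · rintro e (rfl | he)
    exacts [hE.1, h.mem_edges e he]
  · rintro e (rfl | he)
    · rw [hself, hfa]
    · rw [hother e he, h.map_a e he]
  · rintro e (rfl | he)
    · rw [hself, hfb]
    · rw [hother e he, h.map_b e he]
  · rintro e (rfl | he) x hx
    · rw [hself]
      exact fun hy => hfresh x hx.1 hx.2.1 hx.2.2 (hHK _ hy)
    · rw [hother e he]
      exact h.fresh e he x hx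
  · rintro e (rfl | he) x hx e' (rfl | he') x' hx' heq
    · rw [hself] at heq
      exact ⟨rfl, hfinj hx.1 hx'.1 heq⟩
    · rw [hself, hother e' he'] at heq
      exact absurd (heq ▸ hgK e' he' x' hx'.1) (hfresh x hx.1 hx.2.1 hx.2.2)
    · rw [hself, hother e he] at heq
      exact absurd (heq ▸ hgK e he x hx.1) (hfresh x' hx'.1 hx'.2.1 hx'.2.2)
    · rw [hother e he, hother e' he'] at heq
      exact h.inj e he x hx e' he' x' hx' heq
  · intro y
    rw [hverts, Finset.mem_union, h.verts, Finset.mem_image, Set.exists_mem_insert, hself, or_assoc]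
    refine or_congr_right (or_comm.trans (or_congr ?_ ?_))
    · simp only [eq_comm]
    · refine exists_congr fun e => and_congr_right fun he => ?_
      rw [hother e he]
  · exact fun y hy => (hold y (hHK y hy)).trans (h.lab_old y hy)
  · rintro e (rfl | he) x hx
    · rw [hself, hnew x hx]
    · rw [hother e he, hold _ (hgK e he x hx), h.lab_new e he x hx]
  · intro e
    rw [hedges, h.edges, Set.exists_mem_insert, hself, Set.mem_insert_iff, not_or]
    have hrest : (∃ e' ∈ S, ∃ d ∈ (R e').rhs.edges, e = (Function.update g (u, α, w) f e' d.1,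
        d.2.1, Function.update g (u, α, w) f e' d.2.2)) ↔
        ∃ e' ∈ S, ∃ d ∈ (R e').rhs.edges, e = (g e' d.1, d.2.1, g e' d.2.2) :=
      exists_congr fun e' => and_congr_right fun he' => by rw [hother e' he']
    rw [hrest]
    have hne : (∃ e' ∈ S, ∃ d ∈ (R e').rhs.edges, e = (g e' d.1, d.2.1, g e' d.2.2)) →
        e ≠ (u, α, w) := by
      rintro ⟨e', he', d, hd, rfl⟩
      exact hnoenc e' he' d hd
    generalize (∃ e' ∈ S, ∃ d ∈ (R e').rhs.edges, e = (g e' d.1, d.2.1, g e' d.2.2)) = P at hne ⊢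
    rw [or_and_right, and_iff_left_of_imp hne, and_assoc, or_assoc, and_comm (a := e ∉ S),
      or_comm (a := P)]

theorem exists_isExpansion (hT : IsDecodingSystem enc T) (hH : IsEncodedSG enc H)
    (hHK : Relation.ReflTransGen (DecStep enc T) H K) :
    ∃ S g, S ⊆ encEdges enc H ∧ IsExpansion (ruleAt T H) H S g K := by
  induction hHK with
  | refl => exact ⟨∅, fun _ => id, Set.empty_subset _, .refl _ _ _⟩
  | tail _ hstep ih =>
    obtain ⟨S, g, hS, h⟩ := ih
    exact h.decStep hT hH hS hstep

/-- Every encoding edge between node-vertices can be decoded. -/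
theorem exists_decStep (hT : IsDecodingSystem enc T) {e : ℕ × EL × ℕ}
    (he : e ∈ encEdges enc K) {N₁ N₂ : NL} (h₁ : K.lab e.1 = .inl (.inl N₁))
    (h₂ : K.lab e.2.2 = .inl (.inl N₂)) : ∃ K', DecStep enc T K K' := by
  classical
  obtain ⟨u, α, w⟩ := e
  obtain ⟨huw, hα⟩ := he
  obtain ⟨-, -, -, -, hab, hla, hlb, -⟩ := hT α hα N₁ N₂
  have hu : u ∈ K.verts := K.edge_src _ huw
  have hw : w ∈ K.verts := K.edge_tgt _ huw
  have hne : u ≠ w := K.no_loop _ huw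
  obtain ⟨n, hn⟩ : ∃ n, ∀ y ∈ K.verts, y < n :=
    ⟨K.verts.sup id + 1, fun y hy => Nat.lt_succ_of_le (Finset.le_sup (f := id) hy)⟩
  generalize hr : T α N₁ N₂ = r at *
  let f : ℕ → ℕ := fun x => if x = r.a then u else if x = r.b then w else n + x
  have hfa : f r.a = u := by simp [f]
  have hfb : f r.b = w := by simp [f, hab.symm]
  have hfx : ∀ x, x ≠ r.a → x ≠ r.b → f x = n + x := fun x ha hb => by simp [f, ha, hb]
  have hun := hn u hu
  have hwn := hn w hw
  have hfinj : Function.Injective f := by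
    intro x y hxy
    simp only [f] at hxy
    split_ifs at hxy <;> omega
  let lab : ℕ → VLab NL WL NT := fun y => if y < n then K.lab y else r.rhs.lab (y - n)
  have hold : ∀ y ∈ K.verts, lab y = K.lab y := fun y hy => if_pos (hn y hy)
  have hnew : ∀ x, lab (f x) = r.rhs.lab x := by
    intro x
    by_cases ha : x = r.a
    · rw [ha, hfa, hla, hold u hu, h₁]
    by_cases hb : x = r.b
    · rw [hb, hfb, hlb, hold w hw, h₂]
    simp [hfx x ha hb, lab]
  have hmem : ∀ e, e ∈ K.edges.filter (· ≠ (u, α, w)) ∪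
        r.rhs.edges.image (fun d => (f d.1, d.2.1, f d.2.2)) ↔
      (e ∈ K.edges ∧ e ≠ (u, α, w)) ∨ ∃ d ∈ r.rhs.edges, e = (f d.1, d.2.1, f d.2.2) := by
    intro e
    simp only [Finset.mem_union, Finset.mem_filter, Finset.mem_image, eq_comm]
  let K' : SG NL WL NT EL :=
    { verts := K.verts ∪ r.rhs.verts.image f
      edges := K.edges.filter (· ≠ (u, α, w)) ∪
        r.rhs.edges.image (fun d => (f d.1, d.2.1, f d.2.2))
      lab := lab
      edge_src := fun e he => by
        rcases (hmem e).1 he with ⟨he, -⟩ | ⟨d, hd, rfl⟩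
        · exact Finset.mem_union_left _ (K.edge_src e he)
        · exact Finset.mem_union_right _ (Finset.mem_image_of_mem f (r.rhs.edge_src d hd))
      edge_tgt := fun e he => by
        rcases (hmem e).1 he with ⟨he, -⟩ | ⟨d, hd, rfl⟩
        · exact Finset.mem_union_left _ (K.edge_tgt e he)
        · exact Finset.mem_union_right _ (Finset.mem_image_of_mem f (r.rhs.edge_tgt d hd))
      no_loop := fun e he => by
        rcases (hmem e).1 he with ⟨he, -⟩ | ⟨d, hd, rfl⟩
        · exact K.no_loop e he
        · exact hfinj.ne (r.rhs.no_loop d hd) }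
  refine ⟨K', u, α, w, N₁, N₂, f, huw, hα, h₁, h₂, ?_⟩
  rw [hr]
  refine ⟨hfa, hfb, hfinj.injOn, fun x _ ha hb hx => ?_, rfl, hold, fun x _ => hnew x, hmem⟩
  have := hn _ hx
  rw [hfx x ha hb] at this
  omega

theorem encEdges_finite (enc : Finset EL) (H : SG NL WL NT EL) : (encEdges enc H).Finite :=
  H.edges.finite_toSet.subset fun _ he => he.1

theorem DecStep.encEdges_ssubset (hT : IsDecodingSystem enc T) (h : DecStep enc T H K) :
    encEdges enc K ⊂ encEdges enc H := by
  obtain ⟨u, α, w, N₁, N₂, f, huw, hα, -, -, -, -, -, -, -, -, -, hedges⟩ := h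
  have key : ∀ e ∈ encEdges enc K, e ∈ H.edges ∧ e ≠ (u, α, w) := by
    rintro e ⟨he, heα⟩
    rcases (hedges e).1 he with he | ⟨d, hd, rfl⟩
    · exact he
    · exact absurd heα (hT.noEncEdges hα N₁ N₂ d hd)
  have hsub : encEdges enc K ⊆ encEdges enc H := fun e he => ⟨(key e he).1, he.2⟩
  exact (Set.ssubset_iff_of_subset hsub).2
    ⟨(u, α, w), ⟨huw, hα⟩, fun he => (key _ he).2 rfl⟩

theorem DecStep.ncard_encEdges_lt (hT : IsDecodingSystem enc T) (h : DecStep enc T H K) :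
    (encEdges enc K).ncard < (encEdges enc H).ncard :=
  Set.ncard_lt_ncard (h.encEdges_ssubset hT) (encEdges_finite enc H)

theorem wellFounded_decStep (hT : IsDecodingSystem enc T) :
    WellFounded fun K H : SG NL WL NT EL => DecStep enc T H K :=
  Subrelation.wf (fun h => DecStep.ncard_encEdges_lt hT h)
    (measure fun H : SG NL WL NT EL => (encEdges enc H).ncard).wf

theorem exists_normalForm (hT : IsDecodingSystem enc T) (H : SG NL WL NT EL) :
    ∃ M, Relation.ReflTransGen (DecStep enc T) H M ∧ ¬ ∃ K, DecStep enc T M K := by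
  induction H using (wellFounded_decStep hT).induction with
  | _ H ih =>
    by_cases hH : ∃ K, DecStep enc T H K
    · obtain ⟨K, hK⟩ := hH
      obtain ⟨M, hM, hnf⟩ := ih K hK
      exact ⟨M, .head hK hM, hnf⟩
    · exact ⟨H, .refl, hH⟩

/-- A normal form of an encoded string graph is its expansion along all encoding edges. -/
theorem exists_isExpansion_encEdges (hT : IsDecodingSystem enc T) (hH : IsEncodedSG enc H)
    (hHK : Relation.ReflTransGen (DecStep enc T) H K) (hK : ¬ ∃ K', DecStep enc T K K') :
    ∃ g, IsExpansion (ruleAt T H) H (encEdges enc H) g K := by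
  obtain ⟨S, g, hS, h⟩ := exists_isExpansion hT hH hHK
  suffices hSeq : S = encEdges enc H from ⟨g, hSeq ▸ h⟩
  refine hS.antisymm fun e he => by_contra fun heS => hK ?_
  obtain ⟨N₁, N₂, h₁, h₂⟩ := hH.exists_nodeLabels he
  exact exists_decStep hT ((h.mem_encEdges_iff hT hH hS e).2 ⟨he, heS⟩)
    ((h.lab_old _ (H.edge_src e he.1)).trans h₁) ((h.lab_old _ (H.edge_tgt e he.1)).trans h₂)

end

/-- a decoding system is terminating and confluent on encoded
string graphs: every reduction sequence terminates, normal forms exist, any two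
normal forms of the same graph are isomorphic, and normal forms contain no
encoding edges. -/
theorem decoding_confluent_terminating
    {NL WL NT EL : Type}
    (enc : Finset EL) (T : EL → NL → NL → DecRule NL WL NT EL)
    (hT : IsDecodingSystem enc T)
    (H : SG NL WL NT EL) (hH : IsEncodedSG enc H) :
    (∀ f : ℕ → SG NL WL NT EL, f 0 = H → ¬ (∀ n, DecStep enc T (f n) (f (n + 1)))) ∧
    (∃ M, Relation.ReflTransGen (DecStep enc T) H M ∧ ¬ ∃ K, DecStep enc T M K) ∧
    (∀ M M', Relation.ReflTransGen (DecStep enc T) H M → (¬ ∃ K, DecStep enc T M K) →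
      Relation.ReflTransGen (DecStep enc T) H M' → (¬ ∃ K, DecStep enc T M' K) →
      Iso M M') ∧
    (∀ M, Relation.ReflTransGen (DecStep enc T) H M → (¬ ∃ K, DecStep enc T M K) →
      NoEncEdges enc M) := by
  refine ⟨fun f _ hf => ?_, exists_normalForm hT H, fun M M' hM hnf hM' hnf' => ?_,
    fun M hM hnf e he heα => ?_⟩
  · exact (wellFounded_iff_isEmpty_descending_chain.1 (wellFounded_decStep hT)).elim ⟨f, hf⟩
  · obtain ⟨g, h⟩ := exists_isExpansion_encEdges hT hH hM hnf
    obtain ⟨g', h'⟩ := exists_isExpansion_encEdges hT hH hM' hnf'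
    exact h.iso h'
  · obtain ⟨g, h⟩ := exists_isExpansion_encEdges hT hH hM hnf
    obtain ⟨heH, hne⟩ := (h.mem_encEdges_iff hT hH subset_rfl e).1 ⟨he, heα⟩
    exact hne heH

end BESG
end

section
/- Applying a decoding rule of a decoding system T to an encoded string graph preserves the set of inputs and the set of outputs: if H ⟹_T H' then H and H' have the same inputs and the same outputs. Moreover, each decoding step does not decrease the size of the graph, so if H ⟹*_T H' then H' is at least as large as H. -/
set_option linter.dupNamespace false

namespace BESG

variable {NL WL NT EL : Type}

lemma inDeg_eq_zero_iff {H : SG NL WL NT EL} {v : ℕ} :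
    inDeg H v = 0 ↔ ∀ e ∈ H.edges, e.2.2 ≠ v := by
  simp only [inDeg, Finset.card_eq_zero, Finset.filter_eq_empty_iff, ne_eq]

lemma outDeg_eq_zero_iff {H : SG NL WL NT EL} {v : ℕ} :
    outDeg H v = 0 ↔ ∀ e ∈ H.edges, e.1 ≠ v := by
  simp only [outDeg, Finset.card_eq_zero, Finset.filter_eq_empty_iff, ne_eq]

/-- A connected string graph with two distinct node-vertices has a further vertex. -/
lemma IsStringGraph.exists_vert_ne {R : SG NL WL NT EL} (hs : IsStringGraph R)
    (hc : ConnectedG R) {a b : ℕ} (ha : a ∈ R.verts) (hb : b ∈ R.verts) (hab : a ≠ b)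
    (hla : isNodeL (R.lab a)) (hlb : isNodeL (R.lab b)) :
    ∃ x ∈ R.verts, x ≠ a ∧ x ≠ b := by
  rcases (hc a ha b hb).cases_head with h | ⟨x, ⟨γ, h | h⟩, -⟩
  · exact absurd h hab
  · exact ⟨x, R.edge_tgt _ h, (R.no_loop _ h).symm,
      fun hx => hs.2.1 _ h ⟨hla, by simpa [hx] using hlb⟩⟩
  · exact ⟨x, R.edge_src _ h, R.no_loop _ h,
      fun hx => hs.2.1 _ h ⟨by simpa [hx] using hlb, hla⟩⟩

/-- A decoding step leaves the old wire-vertices and the edges at them alone. -/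
lemma DecStep.mem_edges_iff {enc : Finset EL} {T : EL → NL → NL → DecRule NL WL NT EL}
    {H H' : SG NL WL NT EL} (h : DecStep enc T H H') {v : ℕ} (hv : v ∈ H.verts)
    (hw : isWireL (H.lab v)) {e : ℕ × EL × ℕ} (he : e.1 = v ∨ e.2.2 = v) :
    e ∈ H'.edges ↔ e ∈ H.edges := by
  obtain ⟨u, α, w, N₁, N₂, f, -, -, hlu, hlw, hfa, hfb, -, hfresh, -, -, -, hedges⟩ := h
  have hvu : v ≠ u := by rintro rfl; simp [hlu, isWireL] at hw
  have hvw : v ≠ w := by rintro rfl; simp [hlw, isWireL] at hw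
  have hf : ∀ x ∈ (T α N₁ N₂).rhs.verts, f x ≠ v := by
    rintro x hx rfl
    refine hfresh x hx ?_ ?_ hv
    · rintro rfl; exact hvu hfa
    · rintro rfl; exact hvw hfb
  rw [hedges]
  constructor
  · rintro (h | ⟨d, hd, rfl⟩)
    · exact h.1
    · rcases he with he | he
      · exact absurd he (hf _ (Graph.edge_src _ _ hd))
      · exact absurd he (hf _ (Graph.edge_tgt _ _ hd))
  · refine fun h => .inl ⟨h, ?_⟩
    rintro rfl
    rcases he with he | he
    · exact hvu he.symm
    · exact hvw he.symm

/-- The wire-vertices created by a decoding step are neither inputs nor outputs. -/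
lemma DecStep.exists_edges_of_notMem {enc : Finset EL}
    {T : EL → NL → NL → DecRule NL WL NT EL} (hT : IsDecodingSystem enc T)
    {H H' : SG NL WL NT EL} (h : DecStep enc T H H') {v : ℕ} (hv' : v ∈ H'.verts)
    (hv : v ∉ H.verts) (hw : isWireL (H'.lab v)) :
    (∃ e ∈ H'.edges, e.2.2 = v) ∧ ∃ e ∈ H'.edges, e.1 = v := by
  obtain ⟨u, α, w, N₁, N₂, f, -, hα, -, -, -, -, -, -, hverts, -, hlab, hedges⟩ := h
  obtain ⟨-, -, -, -, -, -, -, hin, hout, -⟩ := hT α hα N₁ N₂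
  rw [hverts, Finset.mem_union, or_iff_right hv, Finset.mem_image] at hv'
  obtain ⟨x, hx, rfl⟩ := hv'
  rw [hlab x hx] at hw
  have hi : inDeg (T α N₁ N₂).rhs x ≠ 0 := fun h0 =>
    Finset.notMem_empty x (hin ▸ Finset.mem_filter.2 ⟨hx, hw, h0⟩)
  have ho : outDeg (T α N₁ N₂).rhs x ≠ 0 := fun h0 =>
    Finset.notMem_empty x (hout ▸ Finset.mem_filter.2 ⟨hx, hw, h0⟩)
  rw [Ne, inDeg_eq_zero_iff] at hi
  rw [Ne, outDeg_eq_zero_iff] at ho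
  push Not at hi ho
  obtain ⟨d, hd, hdx⟩ := hi
  obtain ⟨d', hd', hdx'⟩ := ho
  exact ⟨⟨_, (hedges _).2 (.inr ⟨d, hd, rfl⟩), congrArg f hdx⟩,
    ⟨_, (hedges _).2 (.inr ⟨d', hd', rfl⟩), congrArg f hdx'⟩⟩

lemma DecStep.verts_subset {enc : Finset EL} {T : EL → NL → NL → DecRule NL WL NT EL}
    {H H' : SG NL WL NT EL} (h : DecStep enc T H H') : H.verts ⊆ H'.verts := by
  obtain ⟨u, α, w, N₁, N₂, f, -, -, -, -, -, -, -, -, hverts, -⟩ := h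
  exact hverts ▸ Finset.subset_union_left

lemma DecStep.lab_eq {enc : Finset EL} {T : EL → NL → NL → DecRule NL WL NT EL}
    {H H' : SG NL WL NT EL} (h : DecStep enc T H H') {v : ℕ} (hv : v ∈ H.verts) :
    H'.lab v = H.lab v := by
  obtain ⟨u, α, w, N₁, N₂, f, -, -, -, -, -, -, -, -, -, hlab, -⟩ := h
  exact hlab v hv

lemma DecStep.inputs_eq {enc : Finset EL} {T : EL → NL → NL → DecRule NL WL NT EL}
    (hT : IsDecodingSystem enc T) {H H' : SG NL WL NT EL} (h : DecStep enc T H H') :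
    Inputs H' = Inputs H := by
  ext v
  simp only [Inputs, Finset.mem_filter, inDeg_eq_zero_iff]
  constructor
  · rintro ⟨hv', hw, h0⟩
    have hv : v ∈ H.verts := by
      by_contra hv
      obtain ⟨⟨e, he, hev⟩, -⟩ := h.exists_edges_of_notMem hT hv' hv hw
      exact h0 e he hev
    rw [h.lab_eq hv] at hw
    exact ⟨hv, hw, fun e he hev => h0 e ((h.mem_edges_iff hv hw (.inr hev)).2 he) hev⟩
  · rintro ⟨hv, hw, h0⟩
    exact ⟨h.verts_subset hv, by rwa [h.lab_eq hv],
      fun e he hev => h0 e ((h.mem_edges_iff hv hw (.inr hev)).1 he) hev⟩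

lemma DecStep.outputs_eq {enc : Finset EL} {T : EL → NL → NL → DecRule NL WL NT EL}
    (hT : IsDecodingSystem enc T) {H H' : SG NL WL NT EL} (h : DecStep enc T H H') :
    Outputs H' = Outputs H := by
  ext v
  simp only [Outputs, Finset.mem_filter, outDeg_eq_zero_iff]
  constructor
  · rintro ⟨hv', hw, h0⟩
    have hv : v ∈ H.verts := by
      by_contra hv
      obtain ⟨-, e, he, hev⟩ := h.exists_edges_of_notMem hT hv' hv hw
      exact h0 e he hev
    rw [h.lab_eq hv] at hw
    exact ⟨hv, hw, fun e he hev => h0 e ((h.mem_edges_iff hv hw (.inl hev)).2 he) hev⟩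
  · rintro ⟨hv, hw, h0⟩
    exact ⟨h.verts_subset hv, by rwa [h.lab_eq hv],
      fun e he hev => h0 e ((h.mem_edges_iff hv hw (.inl hev)).1 he) hev⟩

/-- The encoding edge lost in a decoding step is made up for by a new vertex. -/
lemma DecStep.size_le {enc : Finset EL} {T : EL → NL → NL → DecRule NL WL NT EL}
    (hT : IsDecodingSystem enc T) {H H' : SG NL WL NT EL} (h : DecStep enc T H H') :
    H.verts.card + H.edges.card ≤ H'.verts.card + H'.edges.card := by
  classical
  have hsub := h.verts_subset
  obtain ⟨u, α, w, N₁, N₂, f, he, hα, -, -, -, -, -, hfresh, hverts, -, -, hedges⟩ := h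
  obtain ⟨hs, hc, ha, hb, hab, hla, hlb, -⟩ := hT α hα N₁ N₂
  obtain ⟨x, hx, hxa, hxb⟩ := hs.exists_vert_ne hc ha hb hab
    (by simp [hla, isNodeL]) (by simp [hlb, isNodeL])
  have hx' : f x ∈ H'.verts :=
    hverts ▸ Finset.mem_union_right _ (Finset.mem_image_of_mem f hx)
  have hlt : H.verts.card < H'.verts.card := Finset.card_lt_card <|
    (Finset.ssubset_iff_of_subset hsub).2 ⟨f x, hx', hfresh x hx hxa hxb⟩
  have hle : (H.edges.erase (u, α, w)).card ≤ H'.edges.card :=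
    Finset.card_le_card fun e h' => (hedges e).2 (.inl (Finset.mem_erase.1 h').symm)
  rw [Finset.card_erase_of_mem he] at hle
  omega

/-- decoding steps preserve the inputs and outputs of an
encoded string graph and do not decrease its size; hence the same holds for
arbitrary decoding sequences. -/
theorem decoding_preserves_io_and_size
    {NL WL NT EL : Type}
    (enc : Finset EL) (T : EL → NL → NL → DecRule NL WL NT EL)
    (hT : IsDecodingSystem enc T)
    (H : SG NL WL NT EL) (hH : IsEncodedSG enc H) :
    (∀ H', DecStep enc T H H' →
      Inputs H' = Inputs H ∧ Outputs H' = Outputs H ∧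
      H.verts.card + H.edges.card ≤ H'.verts.card + H'.edges.card) ∧
    (∀ H', Relation.ReflTransGen (DecStep enc T) H H' →
      Inputs H' = Inputs H ∧ Outputs H' = Outputs H ∧
      H.verts.card + H.edges.card ≤ H'.verts.card + H'.edges.card) := by
  refine ⟨fun H' h => ⟨h.inputs_eq hT, h.outputs_eq hT, h.size_le hT⟩, fun H' h => ?_⟩
  induction h with
  | refl => exact ⟨rfl, rfl, le_rfl⟩
  | tail _ h ih =>
    exact ⟨(h.inputs_eq hT).trans ih.1, (h.outputs_eq hT).trans ih.2.1,
      ih.2.2.trans (h.size_le hT)⟩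

end BESG
end
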